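/- Let E be a finite-dimensional complex vector space and (H_t)_{t∈[0,∞)} a smooth family of Hermitian inner products on E. Then there exists a unique smooth path A: [0,∞) → GL(E) with A(0) = Id such that for every t the endomorphism Ȧ(t)A(t)^{-1} is self-adjoint with respect to H_0, and H_0(A(t)u, A(t)w) = H_t(u, w) for all u, w ∈ E and all t ≥ 0; in particular ‖A(t)s‖_{H_0} = ‖s‖_{H_t} for all s ∈ E. -/

import Mathlib

open Filter Topology

noncomputable section

namespace CSW18

variable {E : Type*} [NormedAddCommGroup E] [NormedSpace ℂ E] [FiniteDimensional ℂ E]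

/-- `A : [0,∞) → GL(E)` is the parallel lift determined by the smooth family of Hermitian
inner products `H_t`: it starts at the identity, is smooth on `[0,∞)`, the logarithmic
derivative `Ȧ(t) A(t)⁻¹` is self-adjoint with respect to `H_0`, and `A(t)` pulls `H_0` back
to `H_t`, i.e. `H_0(A(t)u, A(t)w) = H_t(u, w)`. -/
def IsParallelLift (H : ℝ → E →ₗ⋆[ℂ] E →ₗ[ℂ] ℂ) (A : ℝ → (E →L[ℂ] E)ˣ) : Prop :=
  A 0 = 1 ∧ ContDiffOn ℝ (⊤ : ℕ∞) (fun t => ((A t : (E →L[ℂ] E)ˣ) : E →L[ℂ] E)) (Set.Ici 0) ∧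
  ∀ t ∈ Set.Ici (0 : ℝ),
    (∀ u w : E,
      H 0 ((derivWithin (fun s : ℝ => ((A s : (E →L[ℂ] E)ˣ) : E →L[ℂ] E)) (Set.Ici 0) t *
        (((A t)⁻¹ : (E →L[ℂ] E)ˣ) : E →L[ℂ] E)) u) w
      = H 0 u ((derivWithin (fun s : ℝ => ((A s : (E →L[ℂ] E)ˣ) : E →L[ℂ] E)) (Set.Ici 0) t *
        (((A t)⁻¹ : (E →L[ℂ] E)ˣ) : E →L[ℂ] E)) w)) ∧
    (∀ u w : E, H 0 (((A t : (E →L[ℂ] E)ˣ) : E →L[ℂ] E) u)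
        (((A t : (E →L[ℂ] E)ˣ) : E →L[ℂ] E) w) = H t u w)

section LinearODE

variable {R : Type*} [NormedRing R] [NormedAlgebra ℝ R]

/-- The `n`-th term of the Dyson series solving `X' = X * B`, `X 0 = 1`. -/
def dysonTerm (B : ℝ → R) : ℕ → ℝ → R
  | 0 => fun _ => 1
  | n + 1 => fun t => ∫ s in (0 : ℝ)..t, dysonTerm B n s * B s

lemma continuous_dysonTerm {B : ℝ → R} (hB : Continuous B) (n : ℕ) :
    Continuous (dysonTerm B n) := by
  induction n with
  | zero => exact continuous_const
  | succ n ih =>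
    exact intervalIntegral.continuous_primitive
      (fun a b => (ih.mul hB).intervalIntegrable a b) 0

lemma norm_dysonTerm_le {B : ℝ → R} {T C : ℝ} (hC : ∀ s, |s| ≤ T → ‖B s‖ ≤ C)
    (n : ℕ) {t : ℝ} (ht : |t| ≤ T) :
    ‖dysonTerm B n t‖ ≤ ‖(1 : R)‖ * ((C * |t|) ^ n / n.factorial) := by
  induction n generalizing t with
  | zero => simp [dysonTerm]
  | succ n ih =>
    have hs : ∀ s ∈ Set.uIoc 0 t, |s| ≤ |t| := fun s hs => by
      simpa using Set.abs_sub_left_of_mem_uIcc (Set.uIoc_subset_uIcc hs)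
    have hC0 : 0 ≤ C := (norm_nonneg _).trans (hC t ht)
    calc ‖dysonTerm B (n + 1) t‖
        = ‖∫ s in Set.uIoc 0 t, dysonTerm B n s * B s‖ :=
          intervalIntegral.norm_intervalIntegral_eq _ _ _ _
      _ ≤ ∫ s in Set.uIoc 0 t, ‖(1 : R)‖ * (C ^ (n + 1) / n.factorial) * |s - 0| ^ n := by
          refine MeasureTheory.norm_integral_le_of_norm_le ?_ ?_
          · exact ((by fun_prop : Continuous fun s : ℝ =>
              ‖(1 : R)‖ * (C ^ (n + 1) / n.factorial) * |s - 0| ^ n).integrableOn_uIoc)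
          · refine (MeasureTheory.ae_restrict_iff' measurableSet_uIoc).2 (.of_forall fun s h => ?_)
            have hsT := (hs s h).trans ht
            calc ‖dysonTerm B n s * B s‖ ≤ ‖dysonTerm B n s‖ * ‖B s‖ := norm_mul_le _ _
              _ ≤ ‖(1 : R)‖ * ((C * |s|) ^ n / n.factorial) * C := by
                gcongr
                · exact ih hsT
                · exact hC s hsT
              _ = _ := by rw [sub_zero]; ring
      _ = _ := by
          rw [MeasureTheory.integral_const_mul, integral_pow_abs_sub_uIoc, sub_zero,
            Nat.factorial_succ]
          push_cast
          rw [mul_pow]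
          field_simp

variable [CompleteSpace R]

lemma hasDerivAt_dysonTerm_succ {B : ℝ → R} (hB : Continuous B) (n : ℕ) (t : ℝ) :
    HasDerivAt (dysonTerm B (n + 1)) (dysonTerm B n t * B t) t :=
  ((continuous_dysonTerm hB n).mul hB).integral_hasStrictDerivAt 0 t |>.hasDerivAt

/-- Global existence for the linear differential equation `X' = X * B` in a Banach algebra. -/
theorem exists_hasDerivAt_mul {B : ℝ → R} (hB : Continuous B) :
    ∃ X : ℝ → R, X 0 = 1 ∧ ∀ t, HasDerivAt X (X t * B t) t := by
  have hzero : ∀ n, dysonTerm B (n + 1) 0 = 0 := fun n => intervalIntegral.integral_same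
  have hsum0 : Summable fun n => dysonTerm B n 0 :=
    (summable_nat_add_iff 1).1 (by simp [hzero])
  refine ⟨fun t => ∑' n, dysonTerm B n t, ?_, fun t => ?_⟩
  · change ∑' n, dysonTerm B n 0 = 1
    rw [hsum0.tsum_eq_zero_add]
    simp [dysonTerm]
  set T := |t| + 1
  obtain ⟨C, hC⟩ := (isCompact_Icc (a := -T) (b := T)).exists_bound_of_continuousOn
    hB.continuousOn
  replace hC : ∀ s, |s| ≤ T → ‖B s‖ ≤ C := fun s hs => hC s (abs_le.1 hs)
  have htT : |t| < T := lt_add_one _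
  have hC0 : 0 ≤ C := (norm_nonneg _).trans (hC t htT.le)
  have hT0 : 0 ≤ T := (abs_nonneg t).trans htT.le
  have hbound : ∀ n, ∀ s, |s| ≤ T →
      ‖dysonTerm B n s‖ ≤ ‖(1 : R)‖ * ((C * T) ^ n / n.factorial) := fun n s hs =>
    (norm_dysonTerm_le hC n hs).trans (by gcongr)
  have hsum : Summable fun n : ℕ => ‖(1 : R)‖ * ((C * T) ^ n / n.factorial) :=
    (Real.summable_pow_div_factorial _).mul_left _
  have hsumD : Summable fun n => dysonTerm B n t :=
    .of_norm_bounded hsum fun n => hbound n t htT.le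
  have key : HasDerivAt (fun s => ∑' n, dysonTerm B (n + 1) s)
      (∑' n, dysonTerm B n t * B t) t := by
    refine hasDerivAt_tsum_of_isPreconnected (t := Set.Ioo (-T) T) (y₀ := 0)
      (hsum.mul_right C) isOpen_Ioo isPreconnected_Ioo
      (fun n s _ => hasDerivAt_dysonTerm_succ hB n s) (fun n s hs => ?_)
      (abs_lt.1 (by simpa using (abs_nonneg t).trans_lt htT)) (by simp [hzero])
      (abs_lt.1 htT)
    have hsT : |s| ≤ T := (abs_lt.2 hs).le
    refine (norm_mul_le _ _).trans ?_
    gcongr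
    · exact hbound n s hsT
    · exact hC s hsT
  rw [hsumD.tsum_mul_right] at key
  refine (key.const_add 1).congr_of_eventuallyEq ?_
  filter_upwards [isOpen_Ioo.mem_nhds (abs_lt.1 htT)] with s hs
  have : Summable fun n => dysonTerm B n s :=
    .of_norm_bounded hsum fun n => hbound n s (abs_lt.2 hs).le
  rw [this.tsum_eq_zero_add]
  rfl

end LinearODE

section InvolutiveAlgebra

variable {R : Type*} [NormedRing R] [NormedAlgebra ℝ R]

/-- Solutions of `X' = X * B` are as smooth as `B` allows. -/
lemma contDiffOn_of_hasDerivWithinAt_mul {X B : ℝ → R} {s : Set ℝ} (hs : UniqueDiffOn ℝ s)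
    (hX : ∀ t ∈ s, HasDerivWithinAt X (X t * B t) s t) (hB : ContDiffOn ℝ (⊤ : ℕ∞) B s) :
    ContDiffOn ℝ (⊤ : ℕ∞) X s := by
  refine contDiffOn_infty.2 fun n => ?_
  induction n with
  | zero => exact contDiffOn_zero.2 fun t ht => (hX t ht).continuousWithinAt
  | succ n ih =>
    have hsucc : ((n + 1 : ℕ) : WithTop ℕ∞) = (n : WithTop ℕ∞) + 1 := by push_cast; rfl
    rw [hsucc, contDiffOn_succ_iff_derivWithin hs]
    refine ⟨fun t ht => (hX t ht).differentiableWithinAt, by simp, ?_⟩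
    exact (ih.mul (contDiffOn_infty.1 hB n)).congr fun t ht => (hX t ht).derivWithin (hs t ht)

lemma eq_of_hasDerivWithinAt_zero {K : ℝ → R}
    (hK : ∀ t ∈ Set.Ici (0 : ℝ), HasDerivWithinAt K 0 (Set.Ici 0) t) {t : ℝ} (ht : 0 ≤ t) :
    K t = K 0 :=
  constant_of_has_deriv_right_zero
    (fun s hs => (hK s hs.1).continuousWithinAt.mono Set.Icc_subset_Ici_self)
    (fun s hs => (hK s hs.1).mono (Set.Ici_subset_Ici.2 hs.1)) t (Set.right_mem_Icc.2 ht)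

lemma hasDerivWithinAt_fixed {σ : R →L[ℝ] R} {G : ℝ → R} {G' : R} {s : Set ℝ} {t : ℝ}
    (hs : UniqueDiffWithinAt ℝ s t) (ht : t ∈ s) (hG : HasDerivWithinAt G G' s t)
    (hσG : ∀ t ∈ s, σ (G t) = G t) : σ G' = G' :=
  hs.eq_deriv _ ((σ.hasFDerivAt.comp_hasDerivWithinAt t hG).congr
    (fun r hr => (hσG r hr).symm) (hσG t ht).symm) hG

lemma map_one_of_involution {σ : R →L[ℝ] R} (hσ_mul : ∀ a b, σ (a * b) = σ b * σ a)
    (hσ_inv : ∀ a, σ (σ a) = a) : σ 1 = 1 := by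
  simpa [hσ_inv] using (hσ_mul (σ 1) 1).symm

lemma map_ringInverse_of_involution {σ : R →L[ℝ] R} (hσ_mul : ∀ a b, σ (a * b) = σ b * σ a)
    (hσ_inv : ∀ a, σ (σ a) = a) {g : R} (hg : σ g = g) (hu : IsUnit g) :
    σ (Ring.inverse g) = Ring.inverse g := by
  have h1 : σ (Ring.inverse g) * g = 1 := by
    conv_lhs => rw [← hg]
    rw [← hσ_mul, hg, Ring.mul_inverse_cancel _ hu, map_one_of_involution hσ_mul hσ_inv]
  calc σ (Ring.inverse g) = σ (Ring.inverse g) * (g * Ring.inverse g) := by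
        rw [Ring.mul_inverse_cancel _ hu, mul_one]
    _ = Ring.inverse g := by rw [← mul_assoc, h1, one_mul]

/-- A path `A` of units on `[0,∞)` with `A 0 = 1`, self-adjoint logarithmic derivative and
`A* A = G`, where `σ` plays the role of the adjoint. -/
def IsLiftOf (σ : R →L[ℝ] R) (G : ℝ → R) (A : ℝ → Rˣ) : Prop :=
  A 0 = 1 ∧ ContDiffOn ℝ (⊤ : ℕ∞) (fun t => (A t : R)) (Set.Ici 0) ∧
  ∀ t ∈ Set.Ici (0 : ℝ),
    σ (derivWithin (fun s => (A s : R)) (Set.Ici 0) t * ((A t)⁻¹ : Rˣ)) =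
      derivWithin (fun s => (A s : R)) (Set.Ici 0) t * ((A t)⁻¹ : Rˣ) ∧
    σ (A t) * A t = G t

lemma IsLiftOf.hasDerivWithinAt [IsDedekindFiniteMonoid R] {σ : R →L[ℝ] R}
    (hσ_mul : ∀ a b, σ (a * b) = σ b * σ a) {G : ℝ → R} {A : ℝ → Rˣ} (hA : IsLiftOf σ G A)
    (hu : ∀ t ∈ Set.Ici (0 : ℝ), IsUnit (G t)) {t : ℝ} (ht : t ∈ Set.Ici (0 : ℝ)) :
    HasDerivWithinAt (fun t => (A t : R)) (A t * ((1 / 2 : ℝ) •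
      (Ring.inverse (G t) * derivWithin G (Set.Ici 0) t))) (Set.Ici 0) t := by
  obtain ⟨-, hsmooth, h⟩ := hA
  have hd := (hsmooth.differentiableOn (by simp) t ht).hasDerivWithinAt
  obtain ⟨hS, hAG⟩ := h t ht
  set D := derivWithin (fun s => (A s : R)) (Set.Ici 0) t
  set S := D * ((A t)⁻¹ : Rˣ) with hS_def
  have hD : D = S * A t := by rw [hS_def, Units.inv_mul_cancel_right]
  have hGd : derivWithin G (Set.Ici 0) t = σ D * A t + σ (A t) * D :=
    (((σ.hasFDerivAt.comp_hasDerivWithinAt t hd).mul hd).congr (fun s hs => (h s hs).2.symm)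
      hAG.symm).derivWithin (uniqueDiffOn_Ici 0 t ht)
  have hone : A t * Ring.inverse (G t) * σ (A t) = 1 := mul_eq_one_symm <| by
    rw [← mul_assoc, hAG, Ring.mul_inverse_cancel _ (hu t ht)]
  refine hd.congr_deriv ?_
  have hGd' : derivWithin G (Set.Ici 0) t = (2 : ℝ) • (σ (A t) * D) := by
    rw [hGd, two_smul, hD, hσ_mul, hS, mul_assoc]
  rw [hGd', mul_smul_comm, mul_smul_comm, mul_smul_comm, smul_smul, ← mul_assoc, ← mul_assoc, hone]
  norm_num

variable [CompleteSpace R]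

lemma HasDerivWithinAt.ringInverse {G : ℝ → R} {G' : R} {s : Set ℝ} {t : ℝ}
    (hG : HasDerivWithinAt G G' s t) (hu : IsUnit (G t)) :
    HasDerivWithinAt (fun t => Ring.inverse (G t))
      (-(Ring.inverse (G t) * G' * Ring.inverse (G t))) s t := by
  obtain ⟨u, hu⟩ := hu
  have h := hasFDerivAt_ringInverse (𝕜 := ℝ) u
  rw [hu] at h
  have h2 := h.comp_hasDerivWithinAt t hG
  rw [← hu, Ring.inverse_unit]
  simpa using! h2

/-- Two solutions `X`, `Y` of `X' = X * (½ G⁻¹ G')` starting at `1` satisfy `X G⁻¹ Y* = 1`. -/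
lemma mul_inverse_mul_involution_eq_one {σ : R →L[ℝ] R}
    (hσ_mul : ∀ a b, σ (a * b) = σ b * σ a) (hσ_inv : ∀ a, σ (σ a) = a) {G G' X Y : ℝ → R}
    (hG : ∀ t ∈ Set.Ici (0 : ℝ), HasDerivWithinAt G (G' t) (Set.Ici 0) t)
    (hσG : ∀ t ∈ Set.Ici (0 : ℝ), σ (G t) = G t)
    (hu : ∀ t ∈ Set.Ici (0 : ℝ), IsUnit (G t)) (hG0 : G 0 = 1)
    (hX : ∀ t ∈ Set.Ici (0 : ℝ), HasDerivWithinAt X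
      (X t * ((1 / 2 : ℝ) • (Ring.inverse (G t) * G' t))) (Set.Ici 0) t)
    (hY : ∀ t ∈ Set.Ici (0 : ℝ), HasDerivWithinAt Y
      (Y t * ((1 / 2 : ℝ) • (Ring.inverse (G t) * G' t))) (Set.Ici 0) t)
    (hX0 : X 0 = 1) (hY0 : Y 0 = 1) {t : ℝ} (ht : 0 ≤ t) :
    X t * Ring.inverse (G t) * σ (Y t) = 1 := by
  have h0 : X 0 * Ring.inverse (G 0) * σ (Y 0) = 1 := by
    simp [hX0, hY0, hG0, map_one_of_involution hσ_mul hσ_inv]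
  rw [← h0]
  refine eq_of_hasDerivWithinAt_zero (K := fun t => X t * Ring.inverse (G t) * σ (Y t))
    (fun s hs => ?_) ht
  have hd := ((hX s hs).mul (HasDerivWithinAt.ringInverse (hG s hs) (hu s hs))).mul
    (σ.hasFDerivAt.comp_hasDerivWithinAt s (hY s hs))
  refine HasDerivWithinAt.congr_deriv hd ?_
  have hσG' : σ (G' s) = G' s :=
    hasDerivWithinAt_fixed (uniqueDiffOn_Ici 0 s hs) hs (hG s hs) hσG
  have hσP := map_ringInverse_of_involution hσ_mul hσ_inv (hσG s hs) (hu s hs)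
  simp only [hσ_mul, map_smul, hσG', hσP, Pi.mul_apply, Function.comp, mul_smul_comm,
    smul_mul_assoc, mul_neg,
    neg_mul, add_mul, mul_assoc]
  module

theorem exists_isLiftOf [IsDedekindFiniteMonoid R] {σ : R →L[ℝ] R}
    (hσ_mul : ∀ a b, σ (a * b) = σ b * σ a)
    (hσ_inv : ∀ a, σ (σ a) = a) {G : ℝ → R} (hG : ContDiffOn ℝ (⊤ : ℕ∞) G (Set.Ici 0))
    (hσG : ∀ t ∈ Set.Ici (0 : ℝ), σ (G t) = G t)
    (hu : ∀ t ∈ Set.Ici (0 : ℝ), IsUnit (G t)) (hG0 : G 0 = 1) :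
    ∃ A : ℝ → Rˣ, IsLiftOf σ G A := by
  classical
  have huniq : UniqueDiffOn ℝ (Set.Ici (0 : ℝ)) := uniqueDiffOn_Ici 0
  set G' := derivWithin G (Set.Ici 0) with hG'_def
  obtain ⟨hGdiff, hG'⟩ := (contDiffOn_infty_iff_derivWithin huniq).1 hG
  have hGd : ∀ t ∈ Set.Ici (0 : ℝ), HasDerivWithinAt G (G' t) (Set.Ici 0) t :=
    fun t ht => (hGdiff t ht).hasDerivWithinAt
  set B : ℝ → R := fun t => (1 / 2 : ℝ) • (Ring.inverse (G t) * G' t) with hB_def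
  have hP : ContDiffOn ℝ (⊤ : ℕ∞) (fun t => Ring.inverse (G t)) (Set.Ici 0) := fun t ht => by
    obtain ⟨u, hut⟩ := hu t ht
    have h := contDiffAt_ringInverse ℝ (n := (⊤ : ℕ∞)) u
    rw [hut] at h
    exact h.comp_contDiffWithinAt t (hG t ht)
  have hB : ContDiffOn ℝ (⊤ : ℕ∞) B (Set.Ici 0) := (hP.mul hG').const_smul _
  obtain ⟨X, hX0, hX⟩ := exists_hasDerivAt_mul (B := fun t => B (max 0 t))
    (hB.continuousOn.comp_continuous (by fun_prop) fun t => le_max_left 0 t)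
  replace hX : ∀ t ∈ Set.Ici (0 : ℝ), HasDerivWithinAt X (X t * B t) (Set.Ici 0) t :=
    fun t ht => by
      simpa only [max_eq_right (Set.mem_Ici.1 ht)] using (hX t).hasDerivWithinAt
  have hone : ∀ t ∈ Set.Ici (0 : ℝ), X t * (Ring.inverse (G t) * σ (X t)) = 1 := fun t ht => by
    rw [← mul_assoc]
    exact mul_inverse_mul_involution_eq_one hσ_mul hσ_inv hGd hσG hu hG0 hX hX hX0 hX0 ht
  have hone' : ∀ t ∈ Set.Ici (0 : ℝ), Ring.inverse (G t) * σ (X t) * X t = 1 :=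
    fun t ht => mul_eq_one_symm (hone t ht)
  let A : ℝ → Rˣ := fun t =>
    if ht : t ∈ Set.Ici (0 : ℝ) then
      ⟨X t, Ring.inverse (G t) * σ (X t), hone t ht, hone' t ht⟩ else 1
  have hA : Set.EqOn (fun t => (A t : R)) X (Set.Ici 0) := fun t ht => by
    simp only [A, dif_pos ht]
  refine ⟨A, Units.ext (by simpa [hX0] using hA Set.self_mem_Ici),
    (contDiffOn_of_hasDerivWithinAt_mul huniq hX hB).congr hA, fun t ht => ⟨?_, ?_⟩⟩
  · have hinv : ((A t)⁻¹ : Rˣ) = Ring.inverse (G t) * σ (X t) := by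
      simp only [A, dif_pos ht]; rfl
    have hσG' : σ (G' t) = G' t := hasDerivWithinAt_fixed (huniq t ht) ht (hGd t ht) hσG
    have hσP := map_ringInverse_of_involution hσ_mul hσ_inv (hσG t ht) (hu t ht)
    rw [hinv, derivWithin_congr hA (hA ht), (hX t ht).derivWithin (huniq t ht)]
    simp only [hB_def, hσ_mul, hσ_inv, map_smul, hσG', hσP, mul_smul_comm, smul_mul_assoc,
      mul_assoc]
  · have h : (A t : R) = X t := hA ht
    rw [h]
    calc σ (X t) * X t = G t * (Ring.inverse (G t) * σ (X t) * X t) := by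
          rw [← mul_assoc, ← mul_assoc, Ring.mul_inverse_cancel _ (hu t ht), one_mul]
      _ = G t := by rw [hone' t ht, mul_one]

theorem IsLiftOf.eqOn [IsDedekindFiniteMonoid R] {σ : R →L[ℝ] R}
    (hσ_mul : ∀ a b, σ (a * b) = σ b * σ a)
    (hσ_inv : ∀ a, σ (σ a) = a) {G : ℝ → R} (hG : DifferentiableOn ℝ G (Set.Ici 0))
    (hσG : ∀ t ∈ Set.Ici (0 : ℝ), σ (G t) = G t)
    (hu : ∀ t ∈ Set.Ici (0 : ℝ), IsUnit (G t)) (hG0 : G 0 = 1) {A A' : ℝ → Rˣ}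
    (hA : IsLiftOf σ G A) (hA' : IsLiftOf σ G A') : Set.EqOn A A' (Set.Ici 0) := by
  intro t ht
  have h : ∀ {A'' : ℝ → Rˣ}, IsLiftOf σ G A'' →
      Ring.inverse (G t) * σ (A t) * A'' t = 1 := fun {A''} hA'' =>
    mul_eq_one_symm <| by
      rw [← mul_assoc]
      exact mul_inverse_mul_involution_eq_one hσ_mul hσ_inv
        (fun s hs => (hG s hs).hasDerivWithinAt) hσG hu hG0
        (fun s hs => hA''.hasDerivWithinAt hσ_mul hu hs)
        (fun s hs => hA.hasDerivWithinAt hσ_mul hu hs)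
        (by simp [hA''.1]) (by simp [hA.1]) ht
  exact Units.ext <| calc (A t : R)
      _ = A t * (Ring.inverse (G t) * σ (A t) * A' t) := by rw [h hA', mul_one]
      _ = A' t := by rw [← mul_assoc, mul_eq_one_symm (h hA), one_mul]

end InvolutiveAlgebra

lemma exists_orthonormal_basis {V : Type*} [AddCommGroup V] [Module ℂ V] [FiniteDimensional ℂ V]
    {h : V →ₗ⋆[ℂ] V →ₗ[ℂ] ℂ} (hherm : ∀ u w, h u w = starRingEnd ℂ (h w u))
    (hpos : ∀ u, u ≠ 0 → 0 < (h u u).re) :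
    ∃ b : Module.Basis (Fin (Module.finrank ℂ V)) ℂ V,
      ∀ i j, h (b i) (b j) = if i = j then 1 else 0 := by
  let core : InnerProductSpace.Core ℂ V :=
    { inner := fun u w => h u w
      conj_inner_symm := fun u w => (hherm u w).symm
      re_inner_nonneg := fun u => by
        rcases eq_or_ne u 0 with rfl | hu
        · simp
        · exact (hpos u hu).le
      add_left := fun u v w => by simp
      smul_left := fun u w r => by simp
      definite := fun u hu => by
        by_contra hne
        have := hpos u hne
        rw [hu] at this
        simp at this }
  let _ : NormedAddCommGroup V := core.toNormedAddCommGroup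
  let _ : InnerProductSpace ℂ V := InnerProductSpace.ofCore core.toCore
  exact ⟨(stdOrthonormalBasis ℂ V).toBasis, fun i j => by
    simpa using! orthonormal_iff_ite.1 (stdOrthonormalBasis ℂ V).orthonormal i j⟩

lemma ext_left_of_pos {V : Type*} [AddCommGroup V] [Module ℂ V] {h : V →ₗ⋆[ℂ] V →ₗ[ℂ] ℂ}
    (hpos : ∀ u, u ≠ 0 → 0 < (h u u).re) {u v : V} (huv : ∀ w, h u w = h v w) : u = v := by
  by_contra hne
  have := hpos (u - v) (sub_ne_zero.2 hne)
  simp [huv] at this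

section SesquilinearForms

variable {ι : Type*} [Fintype ι]

/-- The endomorphism representing the sesquilinear form `B` in the basis `b`: if `b` is
orthonormal for `h`, then `h (formEnd b B u) w = B u w`. -/
def formEnd (b : Module.Basis ι ℂ E) (B : E →ₗ⋆[ℂ] E →ₗ[ℂ] ℂ) : E →L[ℂ] E :=
  ∑ i, ∑ j, starRingEnd ℂ (B (b j) (b i)) •
    LinearMap.toContinuousLinearMap ((b.coord j).smulRight (b i))

lemma apply_formEnd [DecidableEq ι] {b : Module.Basis ι ℂ E} {h : E →ₗ⋆[ℂ] E →ₗ[ℂ] ℂ}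
    (hb : ∀ i j, h (b i) (b j) = if i = j then 1 else 0) (B : E →ₗ⋆[ℂ] E →ₗ[ℂ] ℂ) (u w : E) :
    h (formEnd b B u) w = B u w := by
  have key : h ∘ₛₗ (formEnd b B : E →ₗ[ℂ] E) = B :=
    b.ext fun k => b.ext fun l => by
      simp [formEnd, hb, Finsupp.single_apply]
  exact LinearMap.congr_fun (LinearMap.congr_fun key u) w

lemma contDiffOn_formEnd (b : Module.Basis ι ℂ E) {H : ℝ → E →ₗ⋆[ℂ] E →ₗ[ℂ] ℂ} {s : Set ℝ}
    (hH : ∀ u w, ContDiffOn ℝ (⊤ : ℕ∞) (fun t => H t u w) s) :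
    ContDiffOn ℝ (⊤ : ℕ∞) (fun t => formEnd b (H t)) s := by
  unfold formEnd
  refine ContDiffOn.sum fun i _ => ContDiffOn.sum fun j _ => ContDiffOn.smul_const ?_ _
  exact Complex.conjCLE.contDiff.comp_contDiffOn (hH (b j) (b i))

/-- The adjoint with respect to a Hermitian inner product, as a real-linear involution. -/
lemma exists_adjoint {h : E →ₗ⋆[ℂ] E →ₗ[ℂ] ℂ} (hherm : ∀ u w, h u w = starRingEnd ℂ (h w u))
    (hpos : ∀ u, u ≠ 0 → 0 < (h u u).re) :
    ∃ σ : (E →L[ℂ] E) →L[ℝ] (E →L[ℂ] E), ∀ a u w, h (σ a u) w = h u (a w) := by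
  obtain ⟨b, hb⟩ := exists_orthonormal_basis hherm hpos
  let f : (E →L[ℂ] E) → (E →L[ℂ] E) := fun a => formEnd b (h.compl₂ (a : E →ₗ[ℂ] E))
  have hf : ∀ a u w, h (f a u) w = h u (a w) := fun a u w => apply_formEnd hb _ u w
  have : FiniteDimensional ℝ (E →L[ℂ] E) := FiniteDimensional.complexToReal _
  let σ : (E →L[ℂ] E) →ₗ[ℝ] (E →L[ℂ] E) :=
    { toFun := f
      map_add' := fun a a' => ContinuousLinearMap.ext fun u =>
        ext_left_of_pos hpos fun w => by simp [hf]
      map_smul' := fun r a => ContinuousLinearMap.ext fun u =>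
        ext_left_of_pos hpos fun w => by
          have hr : ∀ v : E, r • v = (r : ℂ) • v := fun v => (Complex.coe_smul r v).symm
          change h (f (r • a) u) w = h (r • f a u) w
          rw [hf, smul_apply, hr, hr, map_smul, LinearMap.map_smulₛₗ₂, hf,
            Complex.conj_ofReal] }
  exact ⟨LinearMap.toContinuousLinearMap σ, hf⟩

end SesquilinearForms

lemma isDedekindFiniteMonoid_continuousLinearMap : IsDedekindFiniteMonoid (E →L[ℂ] E) :=
  ⟨fun {a a'} h => by
    rw [← ContinuousLinearMap.coe_inj] at h ⊢
    exact mul_eq_one_comm.1 h⟩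

lemma isUnit_of_injective {g : E →L[ℂ] E} (hg : Function.Injective g) : IsUnit g := by
  obtain ⟨f, hf⟩ := LinearMap.exists_leftInverse_of_injective (g : E →ₗ[ℂ] E)
    (LinearMap.ker_eq_bot.2 hg)
  have h : LinearMap.toContinuousLinearMap f * g = 1 :=
    ContinuousLinearMap.ext fun u => LinearMap.congr_fun hf u
  have := isDedekindFiniteMonoid_continuousLinearMap (E := E)
  exact ⟨⟨g, LinearMap.toContinuousLinearMap f, mul_eq_one_symm h, h⟩, rfl⟩

/-- Given a smooth family `(H_t)_{t ≥ 0}` of Hermitian inner products on a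
finite-dimensional complex vector space `E`, there is a unique smooth path
`A : [0,∞) → GL(E)` with `A(0) = Id` such that `Ȧ(t) A(t)⁻¹` is self-adjoint with respect to
`H_0` and `H_0(A(t)u, A(t)w) = H_t(u,w)` for all `u, w` and all `t ≥ 0`; in particular
`‖A(t)s‖_{H_0} = ‖s‖_{H_t}` for all `s ∈ E`. -/
theorem parallelLift_existsUnique (H : ℝ → E →ₗ⋆[ℂ] E →ₗ[ℂ] ℂ)
    (hherm : ∀ t u w, 0 ≤ t → H t u w = starRingEnd ℂ (H t w u))
    (hpos : ∀ t u, 0 ≤ t → u ≠ 0 → 0 < (H t u u).re)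
    (hsmooth : ∀ u w, ContDiffOn ℝ (⊤ : ℕ∞) (fun t => H t u w) (Set.Ici 0)) :
    (∃ A : ℝ → (E →L[ℂ] E)ˣ, IsParallelLift H A) ∧
    (∀ A A' : ℝ → (E →L[ℂ] E)ˣ, IsParallelLift H A → IsParallelLift H A' →
      Set.EqOn (fun t => ((A t : (E →L[ℂ] E)ˣ) : E →L[ℂ] E))
        (fun t => ((A' t : (E →L[ℂ] E)ˣ) : E →L[ℂ] E)) (Set.Ici 0)) ∧
    (∀ A : ℝ → (E →L[ℂ] E)ˣ, IsParallelLift H A → ∀ t ∈ Set.Ici (0 : ℝ), ∀ s : E,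
      Real.sqrt (H 0 (((A t : (E →L[ℂ] E)ˣ) : E →L[ℂ] E) s)
          (((A t : (E →L[ℂ] E)ˣ) : E →L[ℂ] E) s)).re
        = Real.sqrt (H t s s).re) := by
  have hherm0 : ∀ u w, H 0 u w = starRingEnd ℂ (H 0 w u) := fun u w => hherm 0 u w le_rfl
  have hpos0 : ∀ u, u ≠ 0 → 0 < (H 0 u u).re := fun u => hpos 0 u le_rfl
  obtain ⟨b, hb⟩ := exists_orthonormal_basis hherm0 hpos0
  obtain ⟨σ, hσ⟩ := exists_adjoint hherm0 hpos0
  have hext : ∀ {a a' : E →L[ℂ] E}, (∀ u w, H 0 (a u) w = H 0 (a' u) w) ↔ a = a' :=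
    fun {a a'} => ⟨fun h => ContinuousLinearMap.ext fun u => ext_left_of_pos hpos0 (h u),
      fun h u w => by rw [h]⟩
  have hσ' : ∀ a u w, H 0 u (σ a w) = H 0 (a u) w := fun a u w => by
    rw [hherm0, hσ, ← hherm0]
  have hσ_mul : ∀ a a', σ (a * a') = σ a' * σ a := fun a a' =>
    hext.1 fun u w => by simp [hσ]
  have hσ_inv : ∀ a, σ (σ a) = a := fun a => hext.1 fun u w => by rw [hσ, hσ']
  have : IsDedekindFiniteMonoid (E →L[ℂ] E) := isDedekindFiniteMonoid_continuousLinearMap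
  set G : ℝ → E →L[ℂ] E := fun t => formEnd b (H t)
  have hG : ∀ t u w, H 0 (G t u) w = H t u w := fun t u w => apply_formEnd hb (H t) u w
  have hσG : ∀ t ∈ Set.Ici (0 : ℝ), σ (G t) = G t := fun t ht => hext.1 fun u w => by
    rw [hσ, hherm0, hG, ← hherm t u w ht, hG]
  have hG0 : G 0 = 1 := hext.1 fun u w => by simp [hG]
  have hu : ∀ t ∈ Set.Ici (0 : ℝ), IsUnit (G t) := fun t ht =>
    isUnit_of_injective <| (injective_iff_map_eq_zero _).2 fun u hu => by
      by_contra hne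
      have h := hpos t u ht hne
      rw [← hG, hu] at h
      simp at h
  have hGs : ContDiffOn ℝ (⊤ : ℕ∞) G (Set.Ici 0) := contDiffOn_formEnd b hsmooth
  have hiff : ∀ A, IsParallelLift H A ↔ IsLiftOf σ G A := fun A => by
    refine and_congr_right fun _ => and_congr_right fun _ => forall₂_congr fun t _ =>
      and_congr ?_ ?_
    · rw [← hext]
      refine forall₂_congr fun u w => ?_
      rw [hσ, eq_comm]
    · rw [← hext]
      refine forall₂_congr fun u w => ?_
      rw [hG, mul_apply_eq_comp, hσ]
  refine ⟨?_, fun A A' hA hA' t ht => ?_, fun A hA t ht s => ?_⟩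
  · obtain ⟨A, hA⟩ := exists_isLiftOf hσ_mul hσ_inv hGs hσG hu hG0
    exact ⟨A, (hiff A).2 hA⟩
  · exact congrArg Units.val <| IsLiftOf.eqOn hσ_mul hσ_inv (hGs.differentiableOn (by simp)) hσG hu
      hG0 ((hiff A).1 hA) ((hiff A').1 hA') ht
  · rw [(hA.2.2 t ht).2 s s]

end CSW18
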